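/- In the residual Selmer setting, assume hypotheses (DU1) and (LS1). Then for every finite subset n ⊆ L and every ε ∈ {0,1} there exists a finite subset n' ⊆ L with n ⊆ n' and ρ(n') = ε; in particular every finite subset of L is contained in a core vertex, which may be chosen with ρ = 0 or with ρ = 1. -/

import Mathlib

/-- The Selmer subspace attached to a finite subset `n ⊆ L`: vectors killed by `o ℓ`
for all `ℓ ∉ n` and by `u ℓ` for all `ℓ ∈ n`. -/
def resSel {K V L : Type*} [Field K] [AddCommGroup V] [Module K V]
    (u o : L → (V →ₗ[K] K)) (n : Finset L) : Submodule K V :=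
  (⨅ (ℓ : L) (_ : ℓ ∉ n), LinearMap.ker (o ℓ)) ⊓ (⨅ ℓ ∈ n, LinearMap.ker (u ℓ))

theorem mem_resSel {K V L : Type*} [Field K] [AddCommGroup V] [Module K V]
    {u o : L → (V →ₗ[K] K)} {n : Finset L} {x : V} :
    x ∈ resSel u o n ↔ (∀ ℓ, ℓ ∉ n → o ℓ x = 0) ∧ ∀ ℓ ∈ n, u ℓ x = 0 := by
  simp [resSel]

theorem resSel_inf_ker {K V L : Type*} [Field K] [AddCommGroup V] [Module K V] [DecidableEq L]
    (u o : L → (V →ₗ[K] K)) {n : Finset L} {ℓ : L} (hℓ : ℓ ∉ n) :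
    resSel u o n ⊓ LinearMap.ker (u ℓ) = resSel u o (insert ℓ n) ⊓ LinearMap.ker (o ℓ) := by
  ext x
  simp only [Submodule.mem_inf, mem_resSel, LinearMap.mem_ker, Finset.mem_insert]
  constructor
  · rintro ⟨⟨ho, hu⟩, hx⟩
    refine ⟨⟨fun k hk => ho k fun h => hk (Or.inr h), ?_⟩, ho ℓ hℓ⟩
    rintro k (rfl | hk)
    exacts [hx, hu k hk]
  · rintro ⟨⟨ho, hu⟩, hx⟩
    refine ⟨⟨fun k hk => ?_, fun k hk => hu k (Or.inr hk)⟩, hu ℓ (Or.inl rfl)⟩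
    by_cases h : k = ℓ
    · rwa [h]
    · exact ho k (by tauto)

theorem finrank_inf_ker_add_one {K V : Type*} [Field K] [AddCommGroup V] [Module K V]
    (W : Submodule K V) [FiniteDimensional K W] (f : V →ₗ[K] K) (hf : ∃ x ∈ W, f x ≠ 0) :
    Module.finrank K (W ⊓ LinearMap.ker f : Submodule K V) + 1 = Module.finrank K W := by
  obtain ⟨x, hx, hfx⟩ := hf
  have hne : f.domRestrict W ≠ 0 := fun h => hfx (LinearMap.congr_fun h ⟨x, hx⟩)
  have hker : (LinearMap.ker (f.domRestrict W)).map W.subtype = W ⊓ LinearMap.ker f := by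
    rw [LinearMap.ker_domRestrict, Submodule.map_comap_subtype]
  rw [← hker, Submodule.finrank_map_subtype_eq]
  exact Module.Dual.finrank_ker_add_one_of_ne_zero hne

theorem inf_ker_eq_self {K V : Type*} [Field K] [AddCommGroup V] [Module K V]
    {W : Submodule K V} {f : V →ₗ[K] K} (hf : ¬ ∃ x ∈ W, f x ≠ 0) :
    W ⊓ LinearMap.ker f = W := by
  push Not at hf
  exact inf_eq_left.mpr hf

/-- Adding `ℓ` to `n` lowers the residual rank by one when `u ℓ` is nonzero on the Selmer
space and raises it by one otherwise. -/
theorem finrank_resSel_insert {K V L : Type*} [Field K] [AddCommGroup V] [Module K V]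
    [DecidableEq L] (u o : L → (V →ₗ[K] K)) {n : Finset L} {ℓ : L} (hℓ : ℓ ∉ n)
    [FiniteDimensional K (resSel u o n)] [FiniteDimensional K (resSel u o (insert ℓ n))]
    (h : Xor (∃ x ∈ resSel u o n, u ℓ x ≠ 0) (∃ x ∈ resSel u o (insert ℓ n), o ℓ x ≠ 0)) :
    ((∃ x ∈ resSel u o n, u ℓ x ≠ 0) ∧
      Module.finrank K (resSel u o (insert ℓ n)) + 1 = Module.finrank K (resSel u o n)) ∨
    ((¬ ∃ x ∈ resSel u o n, u ℓ x ≠ 0) ∧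
      Module.finrank K (resSel u o (insert ℓ n)) = Module.finrank K (resSel u o n) + 1) := by
  have key := resSel_inf_ker u o hℓ
  rcases h with ⟨hu, ho⟩ | ⟨ho, hu⟩
  · have hrank := finrank_inf_ker_add_one _ _ hu
    rw [key, inf_ker_eq_self ho] at hrank
    exact Or.inl ⟨hu, hrank⟩
  · have hrank := finrank_inf_ker_add_one _ _ ho
    rw [← key, inf_ker_eq_self hu] at hrank
    exact Or.inr ⟨hu, hrank.symm⟩

/-- In the residual Selmer setting, under (DU1) and (LS1): every finite subset `n ⊆ L`
is contained in a finite subset `n'` with `ρ(n') = ε`, for each `ε ∈ {0,1}`; in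
particular every finite subset of `L` is contained in a core vertex, which may be
chosen with `ρ = 0` or with `ρ = 1`. -/
theorem resSel_core_vertices_exist
    {K V L : Type*} [Field K] [AddCommGroup V] [Module K V] [Infinite L] [DecidableEq L]
    (u o : L → (V →ₗ[K] K))
    (hfin : ∀ n : Finset L, FiniteDimensional K (resSel u o n))
    -- (DU1)
    (hDU1 : ∀ (n : Finset L) (ℓ : L), ℓ ∉ n →
      Xor' (∃ x ∈ resSel u o n, u ℓ x ≠ 0)
           (∃ x ∈ resSel u o (insert ℓ n), o ℓ x ≠ 0))
    -- (LS1)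
    (hLS1 : ∀ (n : Finset L), ∀ x ∈ resSel u o n, x ≠ 0 →
      ∃ ℓ : L, ℓ ∉ n ∧ u ℓ x ≠ 0) :
    ∀ (n : Finset L) (ε : ℕ), ε ≤ 1 →
      ∃ n' : Finset L, n ⊆ n' ∧ Module.finrank K (resSel u o n') = ε := by
  have descend : ∀ (k ε : ℕ) (n : Finset L), Module.finrank K (resSel u o n) = ε + k →
      ∃ n' : Finset L, n ⊆ n' ∧ Module.finrank K (resSel u o n') = ε := by
    intro k ε
    induction k with
    | zero => exact fun n hn => ⟨n, subset_rfl, hn⟩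
    | succ k ih =>
      intro n hn
      have hbot : resSel u o n ≠ ⊥ := by
        intro h
        rw [h, finrank_bot] at hn
        omega
      obtain ⟨x, hx, hx0⟩ := Submodule.exists_mem_ne_zero_of_ne_bot hbot
      obtain ⟨ℓ, hℓ, hux⟩ := hLS1 n x hx hx0
      rcases finrank_resSel_insert u o hℓ (hDU1 n ℓ hℓ) with ⟨-, hrank⟩ | ⟨hu, -⟩
      · obtain ⟨n', hsub, hn'⟩ := ih (insert ℓ n) (by omega)
        exact ⟨n', (Finset.subset_insert ℓ n).trans hsub, hn'⟩
      · exact absurd ⟨x, hx, hux⟩ hu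
  intro n ε hε
  by_cases hle : ε ≤ Module.finrank K (resSel u o n)
  · exact descend (Module.finrank K (resSel u o n) - ε) ε n (by omega)
  · obtain ⟨ℓ, hℓ⟩ := Infinite.exists_notMem_finset n
    refine ⟨insert ℓ n, Finset.subset_insert ℓ n, ?_⟩
    rcases finrank_resSel_insert u o hℓ (hDU1 n ℓ hℓ) with ⟨-, hrank⟩ | ⟨-, hrank⟩ <;> omega
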